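/- (Lemma 5.4, inequality (5.4a), orthant case.) Fix x ∈ ℝ^n, μ > 0, ρ > 0. Suppose λ⋆ ∈ ℝ^m satisfies A·z(x,λ⋆;μ,ρ) = ρb, i.e., λ⋆ is a critical point (hence a global minimizer) of η(x,·;μ,ρ). Let λ ∈ ℝ^m, put Δ := λ − λ⋆, and define δ̃ := √( (1/(ρμ)) · ∑_{i=1}^n (z_i/(s_i+z_i))·(AᵀΔ)_i² ), where s := s(x,λ;μ,ρ) and z := z(x,λ;μ,ρ) (so the Hessian quadratic form is evaluated at λ). If δ̃ < 1, then η(x,λ;μ,ρ) − η(x,λ⋆;μ,ρ) ≤ ( δ̃/(1−δ̃) + ln(1−δ̃) )·ρμ. -/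

import Mathlib

open scoped BigOperators

noncomputable def svec {m n : ℕ} (A : Matrix (Fin m) (Fin n) ℝ) (c x : Fin n → ℝ)
    (lam : Fin m → ℝ) (μ ρ : ℝ) : Fin n → ℝ := fun i =>
  (Real.sqrt ((ρ * x i - c i + A.transpose.mulVec lam i) ^ 2 + 4 * ρ * μ)
    - (ρ * x i - c i + A.transpose.mulVec lam i)) / 2

noncomputable def zvec {m n : ℕ} (A : Matrix (Fin m) (Fin n) ℝ) (c x : Fin n → ℝ)
    (lam : Fin m → ℝ) (μ ρ : ℝ) : Fin n → ℝ := fun i =>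
  (Real.sqrt ((ρ * x i - c i + A.transpose.mulVec lam i) ^ 2 + 4 * ρ * μ)
    + (ρ * x i - c i + A.transpose.mulVec lam i)) / 2

noncomputable def phi {n : ℕ} (y : Fin n → ℝ) : ℝ := -∑ i, Real.log (y i)

noncomputable def Lag {m n : ℕ} (A : Matrix (Fin m) (Fin n) ℝ) (b : Fin m → ℝ)
    (c x : Fin n → ℝ) (lam : Fin m → ℝ) (s : Fin n → ℝ) (μ ρ : ℝ) : ℝ :=
  -(ρ * ∑ j, b j * lam j) + ρ * μ * phi s
    + ρ * ∑ i, x i * (A.transpose.mulVec lam i + s i - c i)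
    + (1 / 2) * ∑ i, (A.transpose.mulVec lam i + s i - c i) ^ 2

noncomputable def eta {m n : ℕ} (A : Matrix (Fin m) (Fin n) ℝ) (b : Fin m → ℝ)
    (c x : Fin n → ℝ) (lam : Fin m → ℝ) (μ ρ : ℝ) : ℝ :=
  Lag A b c x lam (svec A c x lam μ ρ) μ ρ

/-- The function `r ↦ r / (1 - r) + log (1 - r)` as a power series. -/
lemma hasSum_div_add_log {r : ℝ} (h0 : 0 ≤ r) (h1 : r < 1) :
    HasSum (fun k : ℕ => r ^ (k + 1) * (1 - 1 / ((k : ℝ) + 1)))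
      (r / (1 - r) + Real.log (1 - r)) := by
  have hlog := Real.hasSum_pow_div_log_of_abs_lt_one (abs_lt.2 ⟨by linarith, h1⟩)
  have hgeom := (hasSum_geometric_of_lt_one h0 h1).mul_left r
  rw [div_eq_mul_inv, ← sub_neg_eq_add]
  have hterm : (fun k : ℕ => r ^ (k + 1) * (1 - 1 / ((k : ℝ) + 1))) =
      fun k : ℕ => r * r ^ k - r ^ (k + 1) / ((k : ℝ) + 1) := by
    funext k
    ring
  rw [hterm]
  exact hgeom.sub hlog

lemma one_sub_one_div_nat_succ_nonneg (k : ℕ) : 0 ≤ 1 - 1 / ((k : ℝ) + 1) := by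
  rw [sub_nonneg, div_le_one (by positivity)]
  linarith [(Nat.cast_nonneg k : (0 : ℝ) ≤ k)]

lemma half_sq_le_div_add_log {r : ℝ} (h0 : 0 ≤ r) (h1 : r < 1) :
    r ^ 2 / 2 ≤ r / (1 - r) + Real.log (1 - r) := by
  have h := le_hasSum (hasSum_div_add_log h0 h1) 1 fun k _ =>
    mul_nonneg (pow_nonneg h0 _) (one_sub_one_div_nat_succ_nonneg k)
  norm_num at h
  linarith

/-- The quotient of `r / (1 - r) + log (1 - r)` by `r ^ 2` is monotone on `(0, 1)`. -/
lemma div_add_log_mul_sq_le {r d : ℝ} (h0 : 0 ≤ r) (hrd : r ≤ d) (hd : d < 1) :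
    (r / (1 - r) + Real.log (1 - r)) * d ^ 2 ≤ r ^ 2 * (d / (1 - d) + Real.log (1 - d)) := by
  refine hasSum_le (fun k => ?_) ((hasSum_div_add_log h0 (hrd.trans_lt hd)).mul_right (d ^ 2))
    ((hasSum_div_add_log (h0.trans hrd) hd).mul_left (r ^ 2))
  rcases k with _ | k
  · simp
  · have hp : r ^ k ≤ d ^ k := pow_le_pow_left₀ h0 hrd k
    have hc := one_sub_one_div_nat_succ_nonneg (k + 1)
    calc r ^ (k + 1 + 1) * (1 - 1 / (((k + 1 : ℕ) : ℝ) + 1)) * d ^ 2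
        = r ^ k * (r ^ 2 * d ^ 2 * (1 - 1 / (((k + 1 : ℕ) : ℝ) + 1))) := by ring
      _ ≤ d ^ k * (r ^ 2 * d ^ 2 * (1 - 1 / (((k + 1 : ℕ) : ℝ) + 1))) :=
          mul_le_mul_of_nonneg_right hp (by positivity)
      _ = r ^ 2 * (d ^ (k + 1 + 1) * (1 - 1 / (((k + 1 : ℕ) : ℝ) + 1))) := by ring

lemma sub_one_sub_log_le {t : ℝ} (h0 : 0 < t) (h1 : t ≤ 1) :
    t - 1 - Real.log t ≤ (1 - t) ^ 2 / (2 * t) := by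
  have hmono : AntitoneOn (fun y : ℝ => (1 - y) ^ 2 / (2 * y) - (y - 1 - Real.log y))
      (Set.Icc t 1) := by
    have hder : ∀ y ∈ Set.Icc t 1,
        HasDerivAt (fun y : ℝ => (1 - y) ^ 2 / (2 * y) - (y - 1 - Real.log y))
          (-(1 - y) ^ 2 / (2 * y ^ 2)) y := by
      intro y hy
      have hy0 : 0 < y := h0.trans_le hy.1
      have hd := ((((hasDerivAt_id y).const_sub 1).pow 2).div
        ((hasDerivAt_id y).const_mul 2) (by simp [hy0.ne'])).sub
        (((hasDerivAt_id y).sub_const 1).sub (Real.hasDerivAt_log hy0.ne'))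
      refine hd.congr_deriv ?_
      simp only [id, Pi.pow_apply]
      field_simp
      ring
    refine antitoneOn_of_deriv_nonpos (convex_Icc t 1)
      (fun y hy => (hder y hy).continuousAt.continuousWithinAt)
      (fun y hy => (hder y (interior_subset hy)).differentiableAt.differentiableWithinAt) ?_
    intro y hy
    rw [(hder y (interior_subset hy)).deriv]
    exact div_nonpos_of_nonpos_of_nonneg (by nlinarith [sq_nonneg (1 - y)]) (by positivity)
  have h := hmono (Set.left_mem_Icc.2 h1) (Set.right_mem_Icc.2 h1) h1
  norm_num at h
  linarith

/-- The Hessian comparison behind `bregman_le_of_one_le`. -/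
lemma one_add_mul_one_sub_sq_le {a k t : ℝ} (ha : 0 ≤ a) (hk : 0 < k) (hka : k ^ 2 = 1 + a)
    (ht : 1 ≤ t) (hr : (t - 1) * (a + 1 / t) / k < 1) :
    (1 + a) * (1 - (t - 1) * (a + 1 / t) / k) ^ 2 ≤ a + 1 / t ^ 2 := by
  have ht0 : 0 < t := by linarith
  have hk1 : 1 ≤ k := by nlinarith
  set v := 1 / t with hv
  have hv0 : 0 < v := by positivity
  have hvt : v * t = 1 := by rw [hv]; field_simp
  set q := Real.sqrt (a + v ^ 2) with hq
  have hq0 : 0 ≤ q := Real.sqrt_nonneg _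
  have hqsq : q ^ 2 = a + v ^ 2 := Real.sq_sqrt (by positivity)
  have hqv : v ≤ q := Real.le_sqrt_of_sq_le (by linarith)
  have hpos : 0 ≤ k - (t - 1) * (a + v) := by
    rw [div_lt_one hk] at hr
    linarith
  have hkey : k - (t - 1) * (a + v) ≤ q := by
    have h1 : v * (1 + v) ≤ (a + v) * (k + q) :=
      mul_le_mul (by linarith) (by linarith) (by positivity) (by positivity)
    have h2 : (k - q) * (k + q) = (t - 1) * (v * (1 + v)) := by
      linear_combination hka - hqsq - (1 + v) * hvt
    have h3 : (k - q) * (k + q) ≤ ((t - 1) * (a + v)) * (k + q) := by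
      rw [h2, mul_assoc]
      exact mul_le_mul_of_nonneg_left h1 (by linarith)
    linarith [le_of_mul_le_mul_right h3 (by positivity)]
  have hrw : (1 + a) * (1 - (t - 1) * (a + v) / k) ^ 2 = (k - (t - 1) * (a + v)) ^ 2 := by
    rw [← hka]
    field_simp
  have hv2 : 1 / t ^ 2 = v ^ 2 := by rw [hv, one_div_pow]
  rw [hrw, hv2, ← hqsq]
  exact pow_le_pow_left₀ hpos hkey 2

lemma bregman_le_of_one_le {a k T : ℝ} (ha : 0 ≤ a) (hk : 0 < k) (hka : k ^ 2 = 1 + a)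
    (hT : 1 ≤ T) (hr : (T - 1) * (a + 1 / T) / k < 1) :
    a * (1 - T) ^ 2 / 2 + (T - 1 - Real.log T) ≤
      (T - 1) * (a + 1 / T) / k / (1 - (T - 1) * (a + 1 / T) / k) +
        Real.log (1 - (T - 1) * (a + 1 / T) / k) := by
  set R : ℝ → ℝ := fun t => (t - 1) * (a + 1 / t) / k with hR
  have hRlt : ∀ t ∈ Set.Icc 1 T, R t < 1 := by
    intro t ht
    refine lt_of_le_of_lt ?_ hr
    have ht0 : 0 < t := by linarith [ht.1]
    have hT0 : 0 < T := by linarith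
    have e : ∀ y : ℝ, 0 < y → (y - 1) * (a + 1 / y) = (y - 1) * a + (1 - 1 / y) := by
      intro y hy
      field_simp
    have hinv : 1 / T ≤ 1 / t := one_div_le_one_div_of_le ht0 ht.2
    have : (t - 1) * a ≤ (T - 1) * a := mul_le_mul_of_nonneg_right (by linarith [ht.2]) ha
    simp only [hR]
    rw [div_le_div_iff_of_pos_right hk, e t ht0, e T hT0]
    linarith
  have hder : ∀ t ∈ Set.Icc 1 T,
      HasDerivAt (fun t => R t / (1 - R t) + Real.log (1 - R t) -
          (a * (1 - t) ^ 2 / 2 + (t - 1 - Real.log t)))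
        (R t / (1 - R t) ^ 2 * ((a + 1 / t ^ 2) / k) - (t - 1) * (a + 1 / t)) t := by
    intro t ht
    have ht0 : 0 < t := by linarith [ht.1]
    have hRt : 1 - R t ≠ 0 := by linarith [hRlt t ht]
    have hRd : HasDerivAt R ((a + 1 / t ^ 2) / k) t := by
      have h := (((hasDerivAt_id t).sub_const 1).mul
        (((hasDerivAt_const t (1 : ℝ)).div (hasDerivAt_id t) ht0.ne').const_add a)).div_const k
      refine h.congr_deriv ?_
      simp only [id, Pi.div_apply]
      field_simp
      ring
    have h := ((hRd.div (hRd.const_sub 1) hRt).add ((hRd.const_sub 1).log hRt)).sub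
      ((((((hasDerivAt_id t).const_sub 1).pow 2).const_mul a).div_const 2).add
        (((hasDerivAt_id t).sub_const 1).sub (Real.hasDerivAt_log ht0.ne')))
    refine h.congr_deriv ?_
    generalize R t = p at *
    simp only [id]
    field_simp
    ring
  have hmono : MonotoneOn (fun t => R t / (1 - R t) + Real.log (1 - R t) -
      (a * (1 - t) ^ 2 / 2 + (t - 1 - Real.log t))) (Set.Icc 1 T) := by
    refine monotoneOn_of_deriv_nonneg (convex_Icc 1 T)
      (fun t ht => (hder t ht).continuousAt.continuousWithinAt)
      (fun t ht => (hder t (interior_subset ht)).differentiableAt.differentiableWithinAt) ?_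
    intro t ht
    replace ht := interior_subset ht
    rw [(hder t ht).deriv, sub_nonneg]
    have hlt := hRlt t ht
    have ht0 : 0 < t := by linarith [ht.1]
    have hRn : 0 ≤ R t :=
      div_nonneg (mul_nonneg (by linarith [ht.1]) (by positivity)) hk.le
    have hcmp := one_add_mul_one_sub_sq_le ha hk hka ht.1 hlt
    change (1 + a) * (1 - R t) ^ 2 ≤ _ at hcmp
    have hRk : (t - 1) * (a + 1 / t) = R t * k := by
      simp only [hR]
      field_simp
    have hsq : 0 < (1 - R t) ^ 2 := pow_pos (by linarith) 2
    rw [hRk, div_mul_div_comm, le_div_iff₀ (by positivity)]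
    calc R t * k * ((1 - R t) ^ 2 * k) = R t * (k ^ 2 * (1 - R t) ^ 2) := by ring
      _ ≤ R t * (a + 1 / t ^ 2) := by
          rw [hka]
          exact mul_le_mul_of_nonneg_left hcmp hRn
  have h := hmono (Set.left_mem_Icc.2 hT) (Set.right_mem_Icc.2 hT) hT
  simp only [hR] at h
  norm_num at h
  norm_num
  linarith

lemma bregman_le_of_le_one {a k t : ℝ} (ha : 0 ≤ a) (hk : 0 < k) (hka : k ^ 2 = 1 + a)
    (ht0 : 0 < t) (ht : t ≤ 1) (hr : (1 - t) * (a + 1 / t) / k < 1) :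
    a * (1 - t) ^ 2 / 2 + (t - 1 - Real.log t) ≤
      (1 - t) * (a + 1 / t) / k / (1 - (1 - t) * (a + 1 / t) / k) +
        Real.log (1 - (1 - t) * (a + 1 / t) / k) := by
  have hrn : 0 ≤ (1 - t) * (a + 1 / t) / k :=
    div_nonneg (mul_nonneg (by linarith) (by positivity)) hk.le
  refine le_trans ?_ (half_sq_le_div_add_log hrn hr)
  have hlog := sub_one_sub_log_le ht0 ht
  have h1t : 1 ≤ 1 / t := by rwa [le_div_iff₀ ht0, one_mul]
  have hge : (1 - t) ^ 2 * (a + 1 / t) ≤ ((1 - t) * (a + 1 / t) / k) ^ 2 := by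
    rw [div_pow, hka, le_div_iff₀ (by linarith)]
    calc (1 - t) ^ 2 * (a + 1 / t) * (1 + a)
        ≤ (1 - t) ^ 2 * (a + 1 / t) * (a + 1 / t) :=
          mul_le_mul_of_nonneg_left (by linarith) (by positivity)
      _ = _ := by ring
  have e : (1 - t) ^ 2 / (2 * t) = (1 - t) ^ 2 * (1 / t) / 2 := by
    field_simp
  rw [e] at hlog
  linarith

/-- The one-dimensional estimate: the Bregman divergence of `z ^ 2 / 2 - σ * log s`, viewed as a
function of `z - s` on the curve `s * z = σ`, is controlled by the local norm. -/
lemma bregman_le {σ s z S Z : ℝ} (hσ : 0 < σ) (hs : 0 < s) (hz : 0 < z)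
    (hZ : 0 < Z) (hsz : s * z = σ) (hSZ : S * Z = σ) {r : ℝ} (hr0 : 0 ≤ r)
    (hr2 : r ^ 2 = 1 / σ * (z / (s + z) * (z - s - (Z - S)) ^ 2)) (hr1 : r < 1) :
    (z ^ 2 - Z ^ 2) / 2 - σ * (Real.log s - Real.log S) - Z * (z - s - (Z - S)) ≤
      (r / (1 - r) + Real.log (1 - r)) * σ := by
  set a := z / s with ha
  set t := Z / z with ht
  set k := Real.sqrt (1 + a) with hk
  have ha0 : 0 < a := by positivity
  have ht0 : 0 < t := by positivity
  have hk0 : 0 < k := Real.sqrt_pos.2 (by positivity)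
  have hka : k ^ 2 = 1 + a := Real.sq_sqrt (by positivity)
  have hzs : z = a * s := by rw [ha]; field_simp
  have hZt : Z = t * z := by rw [ht]; field_simp
  have hSt : S = s / t := by
    rw [eq_div_iff ht0.ne']
    refine mul_right_cancel₀ hz.ne' ?_
    rw [mul_assoc, ← hZt, hSZ, hsz]
  have hlog : Real.log s - Real.log S = Real.log t := by
    rw [hSt, Real.log_div hs.ne' ht0.ne']
    ring
  have hlhs : (z ^ 2 - Z ^ 2) / 2 - σ * (Real.log s - Real.log S) - Z * (z - s - (Z - S)) =
      (a * (1 - t) ^ 2 / 2 + (t - 1 - Real.log t)) * σ := by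
    rw [hlog, hZt, hSt, ← hsz]
    clear_value a t
    subst hzs
    field_simp
    ring
  have hrsq : r ^ 2 = ((t - 1) * (a + 1 / t) / k) ^ 2 := by
    rw [hr2, hZt, hSt, ← hsz, div_pow, hka]
    clear_value a t
    subst hzs
    field_simp
    ring
  rw [hlhs]
  refine mul_le_mul_of_nonneg_right ?_ hσ.le
  rcases le_total 1 t with h | h
  · have hn : 0 ≤ (t - 1) * (a + 1 / t) / k :=
      div_nonneg (mul_nonneg (by linarith) (by positivity)) hk0.le
    have hreq : r = (t - 1) * (a + 1 / t) / k := (pow_left_inj₀ hr0 hn two_ne_zero).1 hrsq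
    rw [hreq] at hr1 ⊢
    exact bregman_le_of_one_le ha0.le hk0 hka h hr1
  · have hn : 0 ≤ (1 - t) * (a + 1 / t) / k :=
      div_nonneg (mul_nonneg (by linarith) (by positivity)) hk0.le
    have hreq : r = (1 - t) * (a + 1 / t) / k := by
      refine (pow_left_inj₀ hr0 hn two_ne_zero).1 (hrsq.trans ?_)
      ring
    rw [hreq] at hr1 ⊢
    exact bregman_le_of_le_one ha0.le hk0 hka ht0 h hr1

lemma abs_lt_sqrt_sq_add {u τ : ℝ} (hτ : 0 < τ) : |u| < Real.sqrt (u ^ 2 + τ) := by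
  rw [← Real.sqrt_sq_eq_abs]
  exact Real.sqrt_lt_sqrt (sq_nonneg u) (by linarith)

section

variable {m n : ℕ} (A : Matrix (Fin m) (Fin n) ℝ) (b : Fin m → ℝ) (c x : Fin n → ℝ)
  (lam : Fin m → ℝ) {μ ρ : ℝ}

lemma svec_pos (hμ : 0 < μ) (hρ : 0 < ρ) (i : Fin n) : 0 < svec A c x lam μ ρ i := by
  have h := abs_lt_sqrt_sq_add (u := ρ * x i - c i + A.transpose.mulVec lam i)
    (show 0 < 4 * ρ * μ by positivity)
  simp only [svec]
  linarith [(abs_lt.1 h).2]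

lemma zvec_pos (hμ : 0 < μ) (hρ : 0 < ρ) (i : Fin n) : 0 < zvec A c x lam μ ρ i := by
  have h := abs_lt_sqrt_sq_add (u := ρ * x i - c i + A.transpose.mulVec lam i)
    (show 0 < 4 * ρ * μ by positivity)
  simp only [zvec]
  linarith [(abs_lt.1 h).1]

lemma svec_mul_zvec (hμ : 0 < μ) (hρ : 0 < ρ) (i : Fin n) :
    svec A c x lam μ ρ i * zvec A c x lam μ ρ i = ρ * μ := by
  have h := Real.sq_sqrt
    (show 0 ≤ (ρ * x i - c i + A.transpose.mulVec lam i) ^ 2 + 4 * ρ * μ by positivity)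
  simp only [svec, zvec]
  linear_combination h / 4

lemma zvec_sub_svec (i : Fin n) :
    zvec A c x lam μ ρ i - svec A c x lam μ ρ i = ρ * x i - c i + A.transpose.mulVec lam i := by
  simp only [svec, zvec]
  ring

lemma eta_eq : eta A b c x lam μ ρ = -(ρ * ∑ j, b j * lam j) +
    ∑ i, (zvec A c x lam μ ρ i ^ 2 / 2 - ρ * μ * Real.log (svec A c x lam μ ρ i) -
      (ρ * x i) ^ 2 / 2) := by
  have h : ∀ i, A.transpose.mulVec lam i + svec A c x lam μ ρ i - c i =
      zvec A c x lam μ ρ i - ρ * x i := fun i => by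
    linear_combination -zvec_sub_svec (μ := μ) (ρ := ρ) A c x lam i
  simp only [eta, Lag, phi, h]
  have hterm : ∀ i, zvec A c x lam μ ρ i ^ 2 / 2 - ρ * μ * Real.log (svec A c x lam μ ρ i) -
      (ρ * x i) ^ 2 / 2 = ρ * (x i * (zvec A c x lam μ ρ i - ρ * x i)) +
        1 / 2 * (zvec A c x lam μ ρ i - ρ * x i) ^ 2 -
        ρ * μ * Real.log (svec A c x lam μ ρ i) := fun i => by ring
  simp only [hterm]
  rw [Finset.sum_sub_distrib, Finset.sum_add_distrib, ← Finset.mul_sum, ← Finset.mul_sum,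
    ← Finset.mul_sum]
  ring

lemma eta_sub_eta_eq (lamstar : Fin m → ℝ)
    (hstar : A.mulVec (zvec A c x lamstar μ ρ) = ρ • b) :
    eta A b c x lam μ ρ - eta A b c x lamstar μ ρ =
      ∑ i, ((zvec A c x lam μ ρ i ^ 2 - zvec A c x lamstar μ ρ i ^ 2) / 2 -
        ρ * μ * (Real.log (svec A c x lam μ ρ i) - Real.log (svec A c x lamstar μ ρ i)) -
        zvec A c x lamstar μ ρ i * A.transpose.mulVec (lam - lamstar) i) := by
  have hlin : ρ * ∑ j, b j * (lam - lamstar) j =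
      ∑ i, zvec A c x lamstar μ ρ i * A.transpose.mulVec (lam - lamstar) i := by
    change ρ * (b ⬝ᵥ (lam - lamstar)) =
      zvec A c x lamstar μ ρ ⬝ᵥ A.transpose.mulVec (lam - lamstar)
    rw [Matrix.dotProduct_mulVec, Matrix.vecMul_transpose, hstar, smul_dotProduct, smul_eq_mul]
  have hsub : ∑ j, b j * (lam - lamstar) j = ∑ j, b j * lam j - ∑ j, b j * lamstar j := by
    rw [← Finset.sum_sub_distrib]
    exact Finset.sum_congr rfl fun j _ => by rw [Pi.sub_apply, mul_sub]
  rw [Finset.sum_sub_distrib, ← hlin, hsub, eta_eq, eta_eq]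
  have hsum : ∀ F G : Fin n → ℝ, ∑ i, F i = ∑ i, G i + ∑ i, (F i - G i) := fun F G => by
    rw [Finset.sum_sub_distrib]
    ring
  rw [hsum (fun i => zvec A c x lam μ ρ i ^ 2 / 2 - ρ * μ * Real.log (svec A c x lam μ ρ i) -
      (ρ * x i) ^ 2 / 2) (fun i => zvec A c x lamstar μ ρ i ^ 2 / 2 -
      ρ * μ * Real.log (svec A c x lamstar μ ρ i) - (ρ * x i) ^ 2 / 2)]
  have hterm : ∀ i, zvec A c x lam μ ρ i ^ 2 / 2 - ρ * μ * Real.log (svec A c x lam μ ρ i) -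
      (ρ * x i) ^ 2 / 2 - (zvec A c x lamstar μ ρ i ^ 2 / 2 -
      ρ * μ * Real.log (svec A c x lamstar μ ρ i) - (ρ * x i) ^ 2 / 2) =
      (zvec A c x lam μ ρ i ^ 2 - zvec A c x lamstar μ ρ i ^ 2) / 2 -
      ρ * μ * (Real.log (svec A c x lam μ ρ i) - Real.log (svec A c x lamstar μ ρ i)) :=
    fun i => by ring
  simp only [hterm]
  ring

end

/-- The function `r / (1 - r) + log (1 - r)` is superadditive in `r ^ 2`. -/
lemma sum_div_add_log_le {ι : Type*} [Fintype ι] {r : ι → ℝ} {d : ℝ} (hr : ∀ i, 0 ≤ r i)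
    (hd0 : 0 ≤ d) (hd : d < 1) (hsum : ∑ i, r i ^ 2 = d ^ 2) :
    ∑ i, (r i / (1 - r i) + Real.log (1 - r i)) ≤ d / (1 - d) + Real.log (1 - d) := by
  have hle : ∀ i, r i ≤ d := fun i => by
    refine le_of_sq_le_sq ?_ hd0
    rw [← hsum]
    exact Finset.single_le_sum (f := fun i => r i ^ 2) (fun j _ => sq_nonneg _)
      (Finset.mem_univ i)
  rcases hd0.eq_or_lt with rfl | hpos
  · have h0 : ∀ i, r i = 0 := fun i => le_antisymm (hle i) (hr i)
    simp [h0]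
  · refine le_of_mul_le_mul_right ?_ (pow_pos hpos 2)
    rw [Finset.sum_mul]
    calc ∑ i, (r i / (1 - r i) + Real.log (1 - r i)) * d ^ 2
        ≤ ∑ i, r i ^ 2 * (d / (1 - d) + Real.log (1 - d)) :=
          Finset.sum_le_sum fun i _ => div_add_log_mul_sq_le (hr i) (hle i) hd
      _ = (d / (1 - d) + Real.log (1 - d)) * d ^ 2 := by
          rw [← Finset.sum_mul, hsum, mul_comm]

/-- Lemma 5.4, inequality (5.4a), orthant case: if `λ⋆` is a critical
point of `η(x,·;μ,ρ)` and the local-norm distance `δ̃` of `λ` from `λ⋆` (measured in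
the Hessian at `λ`, scaled by `1/(ρμ)`) is `< 1`, then
`η(λ) - η(λ⋆) ≤ (δ̃/(1-δ̃) + ln(1-δ̃))·ρμ`. -/
theorem stmt15 {m n : ℕ} (A : Matrix (Fin m) (Fin n) ℝ) (b : Fin m → ℝ) (c : Fin n → ℝ)
    (x : Fin n → ℝ) (μ ρ : ℝ) (hμ : 0 < μ) (hρ : 0 < ρ)
    (lamstar lam : Fin m → ℝ)
    (hstar : A.mulVec (zvec A c x lamstar μ ρ) = ρ • b)
    (δ : ℝ)
    (hδdef : δ = Real.sqrt ((1 / (ρ * μ)) *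
      ∑ i, (zvec A c x lam μ ρ i /
        (svec A c x lam μ ρ i + zvec A c x lam μ ρ i)) *
          (A.transpose.mulVec (lam - lamstar) i) ^ 2))
    (hδ : δ < 1) :
    eta A b c x lam μ ρ - eta A b c x lamstar μ ρ ≤
      (δ / (1 - δ) + Real.log (1 - δ)) * (ρ * μ) := by
  have hσ : 0 < ρ * μ := mul_pos hρ hμ
  set q : Fin n → ℝ := fun i => 1 / (ρ * μ) * (zvec A c x lam μ ρ i /
    (svec A c x lam μ ρ i + zvec A c x lam μ ρ i) *
      (A.transpose.mulVec (lam - lamstar) i) ^ 2) with hq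
  have hq0 : ∀ i, 0 ≤ q i := fun i => by
    have := svec_pos A c x lam hμ hρ i
    have := zvec_pos A c x lam hμ hρ i
    simp only [hq]
    positivity
  rw [Finset.mul_sum] at hδdef
  have hδ0 : 0 ≤ δ := hδdef ▸ Real.sqrt_nonneg _
  have hδsq : ∑ i, q i = δ ^ 2 := by
    rw [hδdef, Real.sq_sqrt (Finset.sum_nonneg fun i _ => hq0 i)]
  have hsq : ∀ i, Real.sqrt (q i) ^ 2 = q i := fun i => Real.sq_sqrt (hq0 i)
  have hlt : ∀ i, Real.sqrt (q i) < 1 := fun i => by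
    refine lt_of_le_of_lt (Real.sqrt_le_iff.2 ⟨hδ0, ?_⟩) hδ
    rw [← hδsq]
    exact Finset.single_le_sum (fun j _ => hq0 j) (Finset.mem_univ i)
  have hw : ∀ i, A.transpose.mulVec (lam - lamstar) i =
      zvec A c x lam μ ρ i - svec A c x lam μ ρ i -
        (zvec A c x lamstar μ ρ i - svec A c x lamstar μ ρ i) := fun i => by
    rw [zvec_sub_svec, zvec_sub_svec, Matrix.mulVec_sub, Pi.sub_apply]
    ring
  rw [eta_sub_eta_eq A b c x lam lamstar hstar]
  calc _ ≤ ∑ i, (Real.sqrt (q i) / (1 - Real.sqrt (q i)) +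
          Real.log (1 - Real.sqrt (q i))) * (ρ * μ) := by
        refine Finset.sum_le_sum fun i _ => ?_
        rw [hw i]
        refine bregman_le hσ (svec_pos A c x lam hμ hρ i) (zvec_pos A c x lam hμ hρ i)
          (zvec_pos A c x lamstar hμ hρ i)
          (svec_mul_zvec A c x lam hμ hρ i) (svec_mul_zvec A c x lamstar hμ hρ i)
          (Real.sqrt_nonneg _) ?_ (hlt i)
        rw [hsq i, ← hw i]
    _ ≤ _ := by
        rw [← Finset.sum_mul]
        refine mul_le_mul_of_nonneg_right ?_ hσ.le
        exact sum_div_add_log_le (fun i => Real.sqrt_nonneg _) hδ0 hδ (by simpa only [hsq] using hδsq)
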